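/- Let D₁ ◁ D₂ and D₁ ≤ D₃ be extensions of partial K-powered fields where D₁ is full (exp surjective onto Fˣ and F algebraically closed), and let D₄ be the free amalgam of D₂ and D₃ over D₁ (vector spaces amalgamated freely, fields amalgamated linearly disjointly, exp(z₂+z₃) = exp(z₂)·exp(z₃)). Then D₃ ◁ D₄; and if moreover D₁ ◁ D₃, then D₁ ◁ D₄. -/

import Mathlib

open Set Submodule

/-- Relative linear dimension: the dimension of the span of `A ∪ B` modulo the span of `B`. -/
noncomputable def ldim (R : Type*) [DivisionRing R] {V : Type*} [AddCommGroup V] [Module R V]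
    (A B : Set V) : ℕ :=
  Module.finrank R (↥(span R (A ∪ B)) ⧸ (span R B).comap (span R (A ∪ B)).subtype)

/-- Relative transcendence degree of `A` over (the field generated by) `B`. -/
noncomputable def td {F : Type*} [Field F] [CharZero F] (A B : Set F) : ℕ :=
  sSup {n : ℕ | ∃ s : Fin n → F, (∀ i, s i ∈ A) ∧
    AlgebraicIndependent (Algebra.adjoin ℚ B) s}

/-- A partial K-powered field: a ℚ-subspace `D` of a `K`-vector space `V` together with a
partial exponential group homomorphism into `Fˣ`, such that `D` `K`-spans `V` and
`exp(D)` generates `F` as a field. -/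
structure PPF (K : Type) [Field K] [CharZero K] where
  V : Type
  F : Type
  [addV : AddCommGroup V]
  [modK : Module K V]
  [modQ : Module ℚ V]
  [fieldF : Field F]
  [charF : CharZero F]
  D : Submodule ℚ V
  exp : V → F
  exp_ne_zero : ∀ x ∈ D, exp x ≠ 0
  exp_add : ∀ x ∈ D, ∀ y ∈ D, exp (x + y) = exp x * exp y
  spans : span K (D : Set V) = ⊤
  generates : Subfield.closure (exp '' D) = ⊤

attribute [instance] PPF.addV PPF.modK PPF.modQ PPF.fieldF PPF.charF

variable {K : Type} [Field K] [CharZero K]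

/-- The predimension δ(A/B) = ldim_K(A/B) + td(exp A / exp B) − ldim_ℚ(A/B). -/
noncomputable def PPF.delta (P : PPF K) (A B : Set P.V) : ℤ :=
  (ldim K A B : ℤ) + (td (P.exp '' A) (P.exp '' B) : ℤ) - (ldim ℚ A B : ℤ)

/-- A subset is strong in `P` if every finite tuple from the domain `D` has
nonnegative predimension over it. -/
def PPF.StrongIn (P : PPF K) (S : Set P.V) : Prop :=
  ∀ (n : ℕ) (z : Fin n → P.V), (∀ i, z i ∈ P.D) → 0 ≤ P.delta (Set.range z) S

/-- A strong extension `D₀ ◁ D₁` of sub-partial-K-powered fields of `P`: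
kernel-preserving, and every finite tuple from `D₁` has nonnegative predimension over `D₀`. -/
def PPF.StrongExt (P : PPF K) (D₀ D₁ : Submodule ℚ P.V) : Prop :=
  D₀ ≤ D₁ ∧ D₁ ≤ P.D ∧ (∀ x ∈ D₁, P.exp x = 1 → x ∈ D₀) ∧
    ∀ (n : ℕ) (z : Fin n → P.V), (∀ i, z i ∈ D₁) → 0 ≤ P.delta (Set.range z) (D₀ : Set P.V)

/-- The K-powers closure of `A` inside the sub-powered-field `E` of `P`. -/
def PPF.pclIn (P : PPF K) (E : Submodule ℚ P.V) (A : Set P.V) : Submodule ℚ P.V :=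
  sInf {S | A ⊆ S ∧ S ≤ E ∧ ∀ (n : ℕ) (z : Fin n → P.V), (∀ i, z i ∈ E) →
      P.delta (Set.range z) (S : Set P.V) ≤ 0 → ∀ i, z i ∈ S}

/-- Powers-transcendence degree of `A` over `B`, computed in the sub-powered-field `E` of `P`:
the least size of a tuple from `E` whose adjunction to `B` captures `A` in the closure. -/
noncomputable def PPF.ktdIn (P : PPF K) (E : Submodule ℚ P.V) (A B : Set P.V) : ℕ :=
  sInf {m | ∃ s : Fin m → P.V, (∀ i, s i ∈ E) ∧ A ⊆ P.pclIn E (B ∪ Set.range s)}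

/-- `S` is a purely powers-transcendental extension of `D₀` inside `P`: every finite tuple
from `S` not entirely contained in `D₀` has strictly positive predimension over `D₀`. -/
def PPF.PPT (P : PPF K) (D₀ S : Submodule ℚ P.V) : Prop :=
  D₀ ≤ S ∧ ∀ (n : ℕ) (z : Fin n → P.V), (∀ i, z i ∈ S) → (∃ i, z i ∉ D₀) →
    0 < P.delta (Set.range z) (D₀ : Set P.V)

/-- The subfield of `F` generated by the exponentials of `S`. -/
def PPF.fieldOf (P : PPF K) (S : Submodule ℚ P.V) : Subfield P.F :=
  Subfield.closure (P.exp '' S)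

/-- The sub-powered-field `S` of `P` is full: exp maps `S` onto the nonzero elements of its
field, and its field is (relatively) algebraically closed. -/
def PPF.FullSub (P : PPF K) (S : Submodule ℚ P.V) : Prop :=
  S ≤ P.D ∧ (∀ y ∈ P.fieldOf S, y ≠ 0 → ∃ x ∈ S, P.exp x = y) ∧
    ∀ y : P.F, (∃ p : Polynomial P.F, p ≠ 0 ∧ (∀ i, p.coeff i ∈ P.fieldOf S) ∧
      Polynomial.eval y p = 0) → y ∈ P.fieldOf S

/-- `(eV, eF)` is an isomorphism, over the base `D₀`, between the sub-partial-K-powered fields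
of `P` generated by `D₂` and `D₃`: `eV` is a `K`-linear bijection of the vector-space parts
mapping `D₂` onto `D₃` and fixing `D₀`, `eF` is a field isomorphism of the field parts fixing
the field of `D₀`, and the pair commutes with exp. -/
def PPF.IsIsoOver (P : PPF K) (D₂ D₃ D₀ : Submodule ℚ P.V)
    (eV : P.V → P.V) (eF : P.F → P.F) : Prop :=
  Set.BijOn eV (span K (D₂ : Set P.V) : Set P.V) (span K (D₃ : Set P.V)) ∧
  Set.BijOn eV (D₂ : Set P.V) (D₃ : Set P.V) ∧
  (∀ x y : P.V, x ∈ span K (D₂ : Set P.V) → y ∈ span K (D₂ : Set P.V) →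
    eV (x + y) = eV x + eV y) ∧
  (∀ (c : K) (x : P.V), x ∈ span K (D₂ : Set P.V) → eV (c • x) = c • eV x) ∧
  (∀ x ∈ D₀, eV x = x) ∧
  Set.BijOn eF (P.fieldOf D₂ : Set P.F) (P.fieldOf D₃ : Set P.F) ∧
  (∀ x y : P.F, x ∈ P.fieldOf D₂ → y ∈ P.fieldOf D₂ → eF (x + y) = eF x + eF y) ∧
  (∀ x y : P.F, x ∈ P.fieldOf D₂ → y ∈ P.fieldOf D₂ → eF (x * y) = eF x * eF y) ∧
  (∀ x ∈ D₀, eF (P.exp x) = P.exp x) ∧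
  (∀ x ∈ D₂, eF (P.exp x) = P.exp (eV x))

/-- A tuple of elements of `F` is linearly independent over the subfield `S`. -/
def LinIndepOver {F : Type*} [Field F] (S : Subfield F) {n : ℕ} (y : Fin n → F) : Prop :=
  ∀ c : Fin n → F, (∀ i, c i ∈ S) → ∑ i, c i * y i = 0 → ∀ i, c i = 0

section LDim

variable {R : Type*} [DivisionRing R] {V : Type*} [AddCommGroup V] [Module R V]

theorem ldim_eq_map (A B : Set V) :
    ldim R A B = Module.finrank R ↥((span R A).map (span R B).mkQ) := by
  unfold ldim
  let f := (span R B).mkQ.domRestrict (span R (A ∪ B))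
  have hk : LinearMap.ker f = (span R B).comap (span R (A ∪ B)).subtype := by
    ext x
    simp [f, LinearMap.domRestrict_apply]
  have hr : LinearMap.range f = (span R A).map (span R B).mkQ := by
    simp only [f, LinearMap.range_domRestrict]
    rw [span_union, Submodule.map_sup]
    simp
  rw [← hk, ← hr]
  exact f.quotKerEquivRange.finrank_eq

theorem ldim_add (A B : Set V) (hA : A.Finite) :
    ldim R A B + Module.finrank R ↥(span R A ⊓ span R B) = Module.finrank R ↥(span R A) := by
  rw [ldim_eq_map]
  have : FiniteDimensional R (span R A) := FiniteDimensional.span_of_finite R hA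
  let f := (span R B).mkQ.domRestrict (span R A)
  have hr : LinearMap.range f = (span R A).map (span R B).mkQ := by
    simp only [f, LinearMap.range_domRestrict]
  have hk : (LinearMap.ker f).map (span R A).subtype = span R A ⊓ span R B := by
    ext x
    simp [f, LinearMap.domRestrict_apply, and_comm]
  have h := f.finrank_range_add_finrank_ker
  rw [hr] at h
  rw [← h, ← hk]
  congr 1
  exact (Submodule.equivMapOfInjective _ (span R A).injective_subtype _).symm.finrank_eq

end LDim

section TD

variable {F : Type*} [Field F] [CharZero F]

theorem td_bdd (A B : Set F) (hA : A.Finite) :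
    BddAbove {n : ℕ | ∃ s : Fin n → F, (∀ i, s i ∈ A) ∧
      AlgebraicIndependent (Algebra.adjoin ℚ B) s} := by
  refine ⟨A.ncard, ?_⟩
  rintro n ⟨s, hs, hi⟩
  have : (Set.range s).ncard ≤ A.ncard := Set.ncard_le_ncard (by rintro _ ⟨i, rfl⟩; exact hs i) hA
  rwa [← Set.image_univ, Set.ncard_image_of_injective _ hi.injective, Set.ncard_univ,
    Nat.card_fin] at this

theorem td_exists (A B : Set F) (hA : A.Finite) :
    ∃ s : Fin (td A B) → F, (∀ i, s i ∈ A) ∧ AlgebraicIndependent (Algebra.adjoin ℚ B) s := by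
  refine Nat.sSup_mem (s := {n : ℕ | ∃ s : Fin n → F, (∀ i, s i ∈ A) ∧
      AlgebraicIndependent (Algebra.adjoin ℚ B) s}) ⟨0, Fin.elim0, fun i => i.elim0, ?_⟩
    (td_bdd A B hA)
  exact algebraicIndependent_empty_type_iff.2 (FaithfulSMul.algebraMap_injective _ _)

theorem le_td {ι : Type*} [Fintype ι] (A B : Set F) (hA : A.Finite) (t : ι → F)
    (ht : AlgebraicIndependent (Algebra.adjoin ℚ B) t)
    (hAt : ∀ i, IsAlgebraic (Algebra.adjoin (Algebra.adjoin ℚ B) A) (t i)) :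
    Fintype.card ι ≤ td A B := by
  set R := Algebra.adjoin ℚ B
  let M := AlgebraicIndependent.matroid R F
  obtain ⟨I, hI⟩ := M.exists_isBasis A
  have h1 : M.Indep (Set.range t) := AlgebraicIndependent.matroid_indep_iff.2 ht.to_subtype_range
  have h2 : Set.range t ⊆ M.closure A := by
    rintro _ ⟨i, rfl⟩
    have := AlgebraicIndependent.matroid_closure_eq (R := R) (A := F) (s := A)
    change t i ∈ (AlgebraicIndependent.matroid R F).closure A
    rw [this]
    exact hAt i
  have h3 := h1.encard_le_eRk_of_subset h2
  rw [Matroid.eRk_closure_eq, ← hI.encard_eq_eRk] at h3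
  have hIA : I ⊆ A := hI.subset
  have hIf : I.Finite := hA.subset hIA
  have h4 : Fintype.card ι ≤ I.ncard := by
    have h5 : (Set.range t).ncard = Fintype.card ι := by
      rw [← Set.image_univ, Set.ncard_image_of_injective _ ht.injective, Set.ncard_univ,
        Nat.card_eq_fintype_card]
    rw [← h5]
    exact ENat.toNat_le_toNat h3 (by simpa using hIf)
  refine h4.trans ?_
  refine le_csSup (td_bdd A B hA) ?_
  have : Finite I := hIf
  let e := (Finite.equivFin I).symm
  refine ⟨fun i => (e i : F), fun i => hIA (e i).2, ?_⟩
  have := AlgebraicIndependent.matroid_indep_iff.1 hI.indep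
  exact AlgebraicIndependent.comp this e e.injective

theorem algInd_mono {ι : Type*} {B C : Set F} (h : B ⊆ C) {t : ι → F}
    (ht : AlgebraicIndependent (Algebra.adjoin ℚ C) t) :
    AlgebraicIndependent (Algebra.adjoin ℚ B) t := by
  refine AlgebraicIndependent.of_ringHom_of_comp_eq (S := Algebra.adjoin ℚ C) (B := F)
    (Subalgebra.inclusion (Algebra.adjoin_mono h)).toRingHom (RingHom.id F) ?_ ?_ ?_
  · exact ht
  · exact Subalgebra.inclusion_injective _
  · ext x; rfl

theorem td_add_le (A A' B C : Set F) (hA : A.Finite) (hA' : A'.Finite) (hBC : B ⊆ C)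
    (hA'C : A' ⊆ C)
    (halg : ∀ a ∈ A', IsAlgebraic (Algebra.adjoin (Algebra.adjoin ℚ B) A) a) :
    td A' B + td A C ≤ td A B := by
  obtain ⟨s, hs, hsi⟩ := td_exists A' B hA'
  obtain ⟨t, ht, hti⟩ := td_exists A C hA
  let _ : Algebra (Algebra.adjoin ℚ B) (Algebra.adjoin ℚ C) :=
    (Subalgebra.inclusion (Algebra.adjoin_mono hBC)).toRingHom.toAlgebra
  have _ : IsScalarTower (Algebra.adjoin ℚ B) (Algebra.adjoin ℚ C) F :=
    IsScalarTower.of_algebraMap_eq fun x => rfl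
  have h := hsi.sumElim_of_tower (S := Algebra.adjoin ℚ C) (y := t) (by
    rintro _ ⟨i, rfl⟩
    exact ⟨⟨s i, Algebra.subset_adjoin (hA'C (hs i))⟩, rfl⟩) hti
  have := le_td A B hA _ h (by
    rintro (i | i)
    · exact isAlgebraic_algebraMap (A := F)
        (⟨t i, Algebra.subset_adjoin (ht i)⟩ : Algebra.adjoin (Algebra.adjoin ℚ B) A)
    · exact halg _ (hs i))
  simp only [Fintype.card_sum, Fintype.card_fin] at this
  omega

theorem adjoin_le_closure (B : Set F) {x : F} (hx : x ∈ Algebra.adjoin ℚ B) :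
    x ∈ Subfield.closure B := by
  induction hx using Algebra.adjoin_induction with
  | mem x hx => exact Subfield.subset_closure hx
  | algebraMap r => simpa using SubfieldClass.ratCast_mem (Subfield.closure B) r
  | add x y _ _ hx hy => exact add_mem hx hy
  | mul x y _ _ hx hy => exact mul_mem hx hy

/-- Transfer of algebraic independence along linear disjointness. -/
theorem algInd_of_LD {B₁ B₃ : Set F} (S₂ : Subfield F)
    (hfull : ∀ x ∈ Subfield.closure B₁, x ∈ Algebra.adjoin ℚ B₁)
    (hLD : ∀ (n : ℕ) (y : Fin n → F), (∀ i, y i ∈ S₂) →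
      LinIndepOver (Subfield.closure B₁) y → LinIndepOver (Subfield.closure B₃) y)
    {k : ℕ} (s : Fin k → F) (hs : ∀ i, s i ∈ S₂)
    (hi : AlgebraicIndependent (Algebra.adjoin ℚ B₁) s) :
    AlgebraicIndependent (Algebra.adjoin ℚ B₃) s := by
  classical
  rw [algebraicIndependent_iff]
  intro p hp
  let e := p.support.equivFin.symm
  let mon : (Fin k →₀ ℕ) → F := fun m => m.prod fun i j => s i ^ j
  have hlin : LinearIndependent (Algebra.adjoin ℚ B₁) mon := by
    have h1 := (MvPolynomial.basisMonomials (Fin k) (Algebra.adjoin ℚ B₁)).linearIndependent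
    have h2 := h1.map' (MvPolynomial.aeval s).toLinearMap (LinearMap.ker_eq_bot.2 hi)
    have h3 : mon = (MvPolynomial.aeval s).toLinearMap ∘
        (MvPolynomial.basisMonomials (Fin k) (Algebra.adjoin ℚ B₁)) := by
      ext m
      simp [mon, MvPolynomial.aeval_monomial]
    rw [h3]
    exact h2
  have key := hLD p.support.card (fun i => mon (e i)) (fun i => by
      exact prod_mem fun j _ => pow_mem (hs j) _) (by
    intro c hc hsum
    have h3 := hlin.comp (fun i => ((e i : p.support) : Fin k →₀ ℕ))
      (Subtype.val_injective.comp e.injective)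
    rw [Fintype.linearIndependent_iff] at h3
    intro i
    have := h3 (fun i => ⟨c i, hfull _ (hc i)⟩) (by
      simpa [Algebra.smul_def] using hsum) i
    exact congrArg Subtype.val this)
  have h4 := key (fun i => ((MvPolynomial.coeff (e i : Fin k →₀ ℕ) p : Algebra.adjoin ℚ B₃) : F))
    (fun i => adjoin_le_closure _ (MvPolynomial.coeff (e i : Fin k →₀ ℕ) p).2)
    (by
      rw [MvPolynomial.aeval_def, MvPolynomial.eval₂_eq] at hp
      rw [← Finset.sum_coe_sort, ← e.sum_comp] at hp
      exact hp)
  ext m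
  by_cases hm : m ∈ p.support
  · have := h4 (e.symm ⟨m, hm⟩)
    simpa using this
  · simpa [MvPolynomial.mem_support_iff] using hm

end TD

section PPFlemmas

variable {K : Type} [Field K] [CharZero K] (P : PPF K)

theorem PPF.exp_zero : P.exp 0 = 1 := by
  have h := P.exp_add 0 P.D.zero_mem 0 P.D.zero_mem
  rw [add_zero] at h
  exact (mul_eq_left₀ (P.exp_ne_zero 0 P.D.zero_mem)).1 h.symm

theorem PPF.exp_neg {x : P.V} (hx : x ∈ P.D) : P.exp (-x) = (P.exp x)⁻¹ := by
  have h := P.exp_add x hx (-x) (P.D.neg_mem hx)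
  rw [add_neg_cancel, P.exp_zero] at h
  exact (inv_eq_of_mul_eq_one_right h.symm).symm

theorem PPF.exp_nsmul {x : P.V} (hx : x ∈ P.D) (n : ℕ) : P.exp (n • x) = P.exp x ^ n := by
  induction n with
  | zero => simp [P.exp_zero]
  | succ n ih => rw [succ_nsmul, P.exp_add _ (nsmul_mem hx n) _ hx, ih, pow_succ]

theorem PPF.alg_span (R : Subalgebra ℚ P.F) (Z : Set P.V) (hZ : Z ⊆ P.D)
    {x : P.V} (hx : x ∈ span ℚ Z) :
    IsAlgebraic (Algebra.adjoin R (P.exp '' Z)) (P.exp x) := by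
  set S := Algebra.adjoin R (P.exp '' Z)
  have hle : span ℚ Z ≤ P.D := span_le.2 hZ
  induction hx using Submodule.span_induction with
  | mem x h =>
    exact isAlgebraic_algebraMap (A := P.F)
      (⟨_, Algebra.subset_adjoin (mem_image_of_mem _ h)⟩ : S)
  | zero => rw [P.exp_zero]; exact isAlgebraic_one
  | add x y hx hy h1 h2 => rw [P.exp_add x (hle hx) y (hle hy)]; exact h1.mul h2
  | smul q x hx h =>
    have hxD := hle hx
    have hn : P.exp (q.den • (q • x)) = P.exp (q • x) ^ q.den :=
      P.exp_nsmul (P.D.smul_mem q hxD) _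
    have hq : q.den • (q • x) = q.num • x := by
      rw [← Nat.cast_smul_eq_nsmul ℚ, smul_smul, ← Int.cast_smul_eq_zsmul ℚ]
      congr 1
      exact Rat.den_mul_eq_num q
    refine IsAlgebraic.of_pow q.den_pos ?_
    rw [← hn, hq]
    obtain ⟨n, hn | hn⟩ := q.num.eq_nat_or_neg
    · rw [hn, natCast_zsmul, P.exp_nsmul hxD]; exact h.pow n
    · rw [hn, neg_smul, natCast_zsmul, P.exp_neg (nsmul_mem hxD n), P.exp_nsmul hxD]
      exact (h.pow n).inv

end PPFlemmas

/-- **Strongness of free amalgams.**  Let `D₁ ◁ D₂` and `D₁ ≤ D₃` be extensions of partial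
K-powered fields with `D₁` full, and let the ambient structure `P` be the free amalgam of
`D₂` and `D₃` over `D₁` (the K-vector spaces amalgamated freely over that of `D₁`, the
fields amalgamated linearly disjointly over that of `D₁`).  Then `D₃ ◁ P`, and if moreover
`D₁ ◁ D₃` then `D₁ ◁ P`. -/
theorem free_amalgam_strong (P : PPF K) (D₁ D₂ D₃ : Submodule ℚ P.V)
    (hfull : P.FullSub D₁)
    (h12 : P.StrongExt D₁ D₂)
    (h13 : D₁ ≤ D₃) (h2D : D₂ ≤ P.D) (h3D : D₃ ≤ P.D)
    -- the amalgam is generated by D₂ and D₃: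
    (hgen : D₂ ⊔ D₃ = P.D)
    -- the vector spaces are amalgamated freely over V₁:
    (hVfree : span K (D₂ : Set P.V) ⊓ span K (D₃ : Set P.V) = span K (D₁ : Set P.V))
    (hQfree : D₂ ⊓ D₃ = D₁)
    -- the fields F₂, F₃ are linearly disjoint over F₁:
    (hLD : ∀ (n : ℕ) (y : Fin n → P.F), (∀ i, y i ∈ P.fieldOf D₂) →
      LinIndepOver (P.fieldOf D₁) y → LinIndepOver (P.fieldOf D₃) y) :
    P.StrongExt D₃ P.D ∧ (P.StrongExt D₁ D₃ → P.StrongExt D₁ P.D) := by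
  have hfullsub : ∀ x ∈ Subfield.closure (P.exp '' (D₁ : Set P.V)),
      x ∈ Algebra.adjoin ℚ (P.exp '' (D₁ : Set P.V)) := by
    intro x hx
    by_cases h0 : x = 0
    · rw [h0]; exact zero_mem _
    · obtain ⟨w, hw, rfl⟩ := hfull.2.1 x hx h0
      exact Algebra.subset_adjoin ⟨w, hw, rfl⟩
  have h12' : D₁ ≤ D₂ := h12.1
  have hE12 : span K (D₁ : Set P.V) ≤ span K (D₂ : Set P.V) := span_mono h12'
  have hE13 : span K (D₁ : Set P.V) ≤ span K (D₃ : Set P.V) := span_mono h13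
  -- F₂ ∩ F₃ = F₁
  have hinter : ∀ y ∈ P.fieldOf D₂, y ∈ P.fieldOf D₃ → y ∈ P.fieldOf D₁ := by
    intro y hy2 hy3
    by_contra hy1
    have := hLD 2 ![1, y] (by
      intro i; fin_cases i
      · exact one_mem _
      · exact hy2) (by
      intro c hc hsum
      simp only [Fin.sum_univ_two, Matrix.cons_val_zero, Matrix.cons_val_one, mul_one] at hsum
      have h1 : c 1 = 0 := by
        by_contra h1
        apply hy1
        have : y = -(c 0) / c 1 := by field_simp; linear_combination hsum
        rw [this]
        exact div_mem (neg_mem (hc 0)) (hc 1)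
      have h0 : c 0 = 0 := by simpa [h1] using hsum
      intro i; fin_cases i
      · exact h0
      · exact h1)
    have h := this ![-y, 1] (by
      intro i; fin_cases i
      · exact neg_mem hy3
      · exact one_mem _) (by simp) 1
    simp at h
  have hker3 : ∀ x ∈ P.D, P.exp x = 1 → x ∈ D₃ := by
    intro x hx hx1
    rw [← hgen] at hx
    obtain ⟨x2, hx2, x3, hx3, rfl⟩ := Submodule.mem_sup.1 hx
    rw [P.exp_add x2 (h2D hx2) x3 (h3D hx3)] at hx1
    have he : P.exp x2 = P.exp (-x3) := by
      rw [P.exp_neg (h3D hx3)]; exact eq_inv_of_mul_eq_one_left hx1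
    have hF1 : P.exp x2 ∈ P.fieldOf D₁ := by
      apply hinter
      · exact Subfield.subset_closure ⟨x2, hx2, rfl⟩
      · rw [he]; exact Subfield.subset_closure ⟨_, D₃.neg_mem hx3, rfl⟩
    obtain ⟨x1, hx1', h1⟩ := hfull.2.1 _ hF1 (P.exp_ne_zero _ (h2D hx2))
    have hx1D : x1 ∈ P.D := hfull.1 hx1'
    have h2 : x2 + -x1 ∈ D₁ := by
      apply h12.2.2.1 _ (D₂.add_mem hx2 (D₂.neg_mem (h12' hx1')))
      rw [P.exp_add _ (h2D hx2) _ (P.D.neg_mem hx1D), P.exp_neg hx1D, h1]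
      exact mul_inv_cancel₀ (P.exp_ne_zero _ (h2D hx2))
    have h3 : x2 ∈ D₁ := by
      have := D₁.add_mem h2 hx1'
      simpa using this
    exact D₃.add_mem (h13 h3) hx3
  have hldim : ∀ (R : Type) [Field R] [Module R P.V]
      (_ : span R (D₂ : Set P.V) ⊓ span R (D₃ : Set P.V) = span R (D₁ : Set P.V))
      (n : ℕ) (z z2 : Fin n → P.V), (∀ i, z2 i ∈ D₂) → (∀ i, z i - z2 i ∈ D₃) →
      ldim R (Set.range z) (D₃ : Set P.V) = ldim R (Set.range z2) (D₁ : Set P.V) := by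
    intro R _ _ hR n z z2 hz2 hz3
    have e1 : ldim R (Set.range z) (D₃ : Set P.V) = ldim R (Set.range z2) (D₃ : Set P.V) := by
      rw [ldim_eq_map, ldim_eq_map, Submodule.map_span, Submodule.map_span, ← Set.range_comp,
        ← Set.range_comp]
      have : (span R (D₃ : Set P.V)).mkQ ∘ z = (span R (D₃ : Set P.V)).mkQ ∘ z2 := by
        ext i
        simp only [Function.comp_apply, Submodule.mkQ_apply]
        exact (Submodule.Quotient.eq _).2 (subset_span (hz3 i))
      rw [this]
    have a1 := ldim_add (R := R) (Set.range z2) (D₃ : Set P.V) (Set.finite_range z2)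
    have a2 := ldim_add (R := R) (Set.range z2) (D₁ : Set P.V) (Set.finite_range z2)
    have hle : span R (Set.range z2) ≤ span R (D₂ : Set P.V) :=
      span_mono (by rintro _ ⟨i, rfl⟩; exact hz2 i)
    have : span R (Set.range z2) ⊓ span R (D₃ : Set P.V)
        = span R (Set.range z2) ⊓ span R (D₁ : Set P.V) := by
      rw [← hR, ← inf_assoc, inf_eq_left.2 hle]
    rw [this] at a1
    omega
  have hstrong3 : P.StrongExt D₃ P.D := by
    refine ⟨h3D, le_rfl, hker3, ?_⟩
    intro n z hz
    have hdec : ∀ i, ∃ a, a ∈ D₂ ∧ z i - a ∈ D₃ := by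
      intro i
      have := hz i
      rw [← hgen] at this
      obtain ⟨x2, hx2, x3, hx3, h⟩ := Submodule.mem_sup.1 this
      exact ⟨x2, hx2, by rw [← h]; simpa using hx3⟩
    choose z2 hz2 hz3 using hdec
    have hpos := h12.2.2.2 n z2 hz2
    unfold PPF.delta at hpos ⊢
    rw [hldim K hVfree n z z2 hz2 hz3,
      hldim ℚ (by simpa only [Submodule.span_eq] using hQfree) n z z2 hz2 hz3]
    have htd : td (P.exp '' Set.range z2) (P.exp '' (D₁ : Set P.V)) ≤
        td (P.exp '' Set.range z) (P.exp '' (D₃ : Set P.V)) := by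
      obtain ⟨s, hs, hsi⟩ := td_exists (P.exp '' Set.range z2) (P.exp '' (D₁ : Set P.V))
        ((Set.finite_range z2).image _)
      have hsi3 : AlgebraicIndependent (Algebra.adjoin ℚ (P.exp '' (D₃ : Set P.V))) s := by
        refine algInd_of_LD (P.fieldOf D₂) hfullsub hLD s ?_ hsi
        intro i
        obtain ⟨_, ⟨j, rfl⟩, h⟩ := hs i
        rw [← h]
        exact Subfield.subset_closure ⟨z2 j, hz2 j, rfl⟩
      have := le_td (P.exp '' Set.range z) _ ((Set.finite_range z).image _) s hsi3 (by
        intro i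
        obtain ⟨_, ⟨j, rfl⟩, h⟩ := hs i
        have hzj : z2 j = z j + -(z j - z2 j) := by abel
        rw [← h, hzj, P.exp_add _ (hz j) _ (P.D.neg_mem (h3D (hz3 j)))]
        refine IsAlgebraic.mul ?_ ?_
        · exact isAlgebraic_algebraMap (A := P.F)
            (⟨_, Algebra.subset_adjoin ⟨z j, ⟨j, rfl⟩, rfl⟩⟩ :
              Algebra.adjoin (Algebra.adjoin ℚ (P.exp '' (D₃ : Set P.V))) (P.exp '' Set.range z))
        · refine isAlgebraic_algebraMap (A := P.F)
            (⟨_, ?_⟩ :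
              Algebra.adjoin (Algebra.adjoin ℚ (P.exp '' (D₃ : Set P.V))) (P.exp '' Set.range z))
          exact Subalgebra.algebraMap_mem _ (⟨_, Algebra.subset_adjoin
            ⟨_, D₃.neg_mem (hz3 j), rfl⟩⟩ : Algebra.adjoin ℚ (P.exp '' (D₃ : Set P.V))))
      simpa using this
    omega
  refine ⟨hstrong3, fun h => ⟨h13.trans h3D, le_rfl, ?_, ?_⟩⟩
  · intro x hx hx1
    exact h.2.2.1 x (hker3 x hx hx1) hx1
  · intro n z hz
    have : FiniteDimensional ℚ (span ℚ (Set.range z)) :=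
      FiniteDimensional.span_of_finite ℚ (Set.finite_range z)
    have : FiniteDimensional K (span K (Set.range z)) :=
      FiniteDimensional.span_of_finite K (Set.finite_range z)
    have : FiniteDimensional ℚ ↥(span ℚ (Set.range z) ⊓ D₃) :=
      Submodule.finiteDimensional_of_le inf_le_left
    obtain ⟨m, w, hw⟩ := Submodule.fg_iff_exists_fin_generating_family.1
      (Submodule.fg_iff_finiteDimensional (span ℚ (Set.range z) ⊓ D₃) |>.2 inferInstance)
    have hwm : ∀ i, w i ∈ span ℚ (Set.range z) ⊓ D₃ := by
      intro i; rw [← hw]; exact subset_span ⟨i, rfl⟩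
    have hwpos := h.2.2.2 m w (fun i => (hwm i).2)
    have hzpos := hstrong3.2.2.2 n z hz
    have fz := Set.finite_range z
    have fw := Set.finite_range w
    unfold PPF.delta at hwpos hzpos ⊢
    have htd := td_add_le (P.exp '' Set.range z) (P.exp '' Set.range w)
      (P.exp '' (D₁ : Set P.V)) (P.exp '' (D₃ : Set P.V)) (fz.image _) (fw.image _)
      (Set.image_mono h13)
      (by rintro _ ⟨_, ⟨i, rfl⟩, rfl⟩; exact ⟨_, (hwm i).2, rfl⟩)
      (by
        rintro _ ⟨_, ⟨i, rfl⟩, rfl⟩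
        exact P.alg_span _ _ (by rintro _ ⟨j, rfl⟩; exact hz j) (hwm i).1)
    have q1 := ldim_add (R := ℚ) (Set.range z) (D₁ : Set P.V) fz
    have q2 := ldim_add (R := ℚ) (Set.range w) (D₁ : Set P.V) fw
    have q3 := ldim_add (R := ℚ) (Set.range z) (D₃ : Set P.V) fz
    have k1 := ldim_add (R := K) (Set.range z) (D₁ : Set P.V) fz
    have k2 := ldim_add (R := K) (Set.range w) (D₁ : Set P.V) fw
    have k3 := ldim_add (R := K) (Set.range z) (D₃ : Set P.V) fz
    rw [Submodule.span_eq] at q1 q2 q3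
    rw [hw, inf_assoc, inf_eq_right.2 h13] at q2
    have hwK : span K (Set.range w) ≤ span K (Set.range z) ⊓ span K (D₃ : Set P.V) := by
      rw [span_le]
      rintro _ ⟨i, rfl⟩
      refine ⟨?_, subset_span (hwm i).2⟩
      have := (hwm i).1
      exact Submodule.span_le_restrictScalars ℚ K (Set.range z) this
    have : FiniteDimensional K (span K (Set.range w)) :=
      FiniteDimensional.span_of_finite K fw
    have : FiniteDimensional K ↥(span K (Set.range z) ⊓ span K (D₁ : Set P.V)) :=
      Submodule.finiteDimensional_of_le inf_le_left
    have : FiniteDimensional K ↥(span K (Set.range z) ⊓ span K (D₃ : Set P.V)) :=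
      Submodule.finiteDimensional_of_le inf_le_left
    have s1 := Submodule.finrank_sup_add_finrank_inf_eq (span K (Set.range w))
      (span K (Set.range z) ⊓ span K (D₁ : Set P.V))
    have s2 : span K (Set.range w) ⊔ (span K (Set.range z) ⊓ span K (D₁ : Set P.V)) ≤
        span K (Set.range z) ⊓ span K (D₃ : Set P.V) :=
      sup_le hwK (inf_le_inf_left _ hE13)
    have s3 := Submodule.finrank_mono s2
    rw [← inf_assoc, inf_eq_left.2 (hwK.trans inf_le_left)] at s1
    omega
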